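/- For every z ∈ F_q*, one has the identity of complex numbers q·(N_2(z) − q) = −2q + χ̄(z)·G(χ,ψ)³ + χ(z)·G(χ̄,ψ)³. -/

import Mathlib

/-- `Ncube F s z` is the number of `s`-tuples `(x₁, …, x_s) ∈ F^s` with
`x₁³ + ⋯ + x_s³ = z`. -/
noncomputable def Ncube (F : Type) [Field F] [Fintype F] (s : ℕ) (z : F) : ℕ :=
  Nat.card {x : Fin s → F // ∑ i, x i ^ 3 = z}

open Finset

namespace MulChar

variable {F : Type*} [Field F] [Fintype F]

/-- An element of a finite field is an `n`-th power as soon as some multiplicative character of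
order `n` takes the value `1` on it. -/
lemma exists_pow_eq_of_apply_eq_one {R : Type*} [CommRing R] {χ : MulChar F R} {a : F}
    (ha : a ≠ 0) (h : χ a = 1) : ∃ b : F, b ^ orderOf χ = a := by
  obtain ⟨g, hg⟩ := IsCyclic.exists_monoid_generator (α := Fˣ)
  have hg' : ∀ x : Fˣ, x ∈ Subgroup.zpowers g := fun x ↦
    Submonoid.powers_le_zpowers g (hg x)
  obtain ⟨n, hn⟩ := hg (Units.mk0 a ha)
  replace hn : (g : F) ^ n = a := by simpa using congrArg Units.val hn
  have hdvd : orderOf χ ∣ n := by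
    rw [orderOf_dvd_iff_pow_eq_one, MulChar.eq_iff hg', MulChar.pow_apply_coe,
      MulChar.one_apply_coe, ← map_pow, hn, h]
  obtain ⟨m, rfl⟩ := hdvd
  exact ⟨(g : F) ^ m, by rw [← pow_mul, mul_comm, hn]⟩

/-- The number of cube roots of `a` is `1 + χ(a) + χ⁻¹(a)` when `χ` is a cubic character. -/
lemma card_cube_roots [DecidableEq F] {R : Type*} [CommRing R] [IsDomain R] {χ : MulChar F R}
    (hχ : orderOf χ = 3) (a : F) :
    ((#{x : F | x ^ 3 = a} : ℕ) : R) = 1 + χ a + χ⁻¹ a := by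
  rcases eq_or_ne a 0 with rfl | ha
  · have : ({x : F | x ^ 3 = 0} : Finset F) = {0} := by ext; simp
    simp only [this, card_singleton, MulChar.map_zero]
    norm_num
  have hχ3 : χ ^ 3 = 1 := hχ ▸ pow_orderOf_eq_one χ
  have hinv : χ⁻¹ a = χ a ^ 2 := by
    rw [← MulChar.pow_apply' χ two_ne_zero, inv_eq_of_mul_eq_one_right (b := χ ^ 2)]
    rw [← hχ3, pow_succ' χ 2]
  have hcube : χ a ^ 3 = 1 := by
    rw [← MulChar.pow_apply' χ three_ne_zero, hχ3, MulChar.one_apply ha.isUnit]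
  rw [hinv]
  by_cases h : χ a = 1
  · obtain ⟨b, hb⟩ := exists_pow_eq_of_apply_eq_one ha h
    rw [hχ] at hb
    obtain ⟨g, hg⟩ := IsCyclic.exists_ofOrder_eq_natCard (α := Fˣ)
    obtain ⟨m, hm⟩ := hχ ▸ χ.orderOf_dvd_card_sub_one
    have hord : orderOf g = m * 3 := by
      rw [hg, Nat.card_eq_fintype_card, Fintype.card_units, hm, mul_comm]
    have hζ : IsPrimitiveRoot (g ^ m : Fˣ) 3 :=
      (IsPrimitiveRoot.orderOf g).pow (_root_.orderOf_pos g) hord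
    have hζ' : IsPrimitiveRoot ((g ^ m : Fˣ) : F) 3 := IsPrimitiveRoot.coe_units_iff.mpr hζ
    have hset : ({x : F | x ^ 3 = a} : Finset F) = (Polynomial.nthRoots 3 a).toFinset := by
      ext x
      simp [Polynomial.mem_nthRoots]
    rw [hset, Multiset.toFinset_card_of_nodup (hζ'.nthRoots_nodup ha), hζ'.card_nthRoots,
      if_pos ⟨b, hb⟩, h]
    norm_num
  · have hset : ({x : F | x ^ 3 = a} : Finset F) = ∅ := by
      refine filter_eq_empty_iff.mpr fun x _ hx ↦ h ?_
      have hx0 : x ≠ 0 := by rintro rfl; exact ha (by simpa using hx.symm)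
      rw [← hx, map_pow, ← MulChar.pow_apply' χ three_ne_zero, hχ3, MulChar.one_apply hx0.isUnit]
    rw [hset, card_empty, Nat.cast_zero]
    refine (mul_left_cancel₀ (sub_ne_zero.mpr h) ?_).symm
    linear_combination hcube

end MulChar

/-- Homogeneity of Jacobi sums. -/
lemma sum_mulChar_mul_sub_eq {F R : Type*} [Field F] [Fintype F] [CommRing R]
    (χ φ : MulChar F R) {z : F} (hz : z ≠ 0) :
    ∑ a, χ a * φ (z - a) = χ z * φ z * jacobiSum χ φ := by
  rw [← Equiv.sum_comp (Equiv.mulLeft₀ z hz), jacobiSum, mul_sum]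
  refine sum_congr rfl fun a _ ↦ ?_
  rw [Equiv.mulLeft₀_apply, ← mul_one_sub, map_mul, map_mul]
  ring

lemma Ncube_two_eq_sum {F : Type} [Field F] [Fintype F] [DecidableEq F] (z : F) :
    Ncube F 2 z = ∑ a : F, #{x : F | x ^ 3 = a} * #{x : F | x ^ 3 = z - a} := by
  have hcard : Ncube F 2 z = #{x : F × F | x.1 ^ 3 + x.2 ^ 3 = z} := by
    rw [Ncube, ← Fintype.card_subtype, ← Nat.card_eq_fintype_card]
    exact Nat.card_congr ((finTwoArrowEquiv F).subtypeEquiv fun x ↦ by simp [Fin.sum_univ_two])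
  rw [hcard, card_eq_sum_card_fiberwise (f := fun x ↦ x.1 ^ 3) (t := univ) (by simp)]
  refine sum_congr rfl fun a _ ↦ ?_
  rw [← card_product]
  congr 1
  ext x
  simp only [mem_filter, mem_univ, true_and, mem_product]
  grind

/-- The number of representations of `z ≠ 0` as a sum of two cubes, via Jacobi sums. -/
lemma Ncube_two_eq_jacobiSum {F : Type} [Field F] [Fintype F] {R : Type*} [CommRing R]
    [IsDomain R] {χ : MulChar F R} (hχ : orderOf χ = 3) {z : F} (hz : z ≠ 0) :
    (Ncube F 2 z : R) = Fintype.card F - 2 * χ (-1)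
      + χ⁻¹ z * jacobiSum χ χ + χ z * jacobiSum χ⁻¹ χ⁻¹ := by
  classical
  have hχ1 : χ ≠ 1 := by rintro rfl; simp at hχ
  have hχ3 : χ ^ 3 = 1 := hχ ▸ pow_orderOf_eq_one χ
  have hsq : χ * χ = χ⁻¹ := by rw [eq_inv_iff_mul_eq_one, ← hχ3, pow_three']
  have hsq' : χ⁻¹ * χ⁻¹ = χ := by rw [← mul_inv, hsq, inv_inv]
  have hmul : χ z * χ⁻¹ z = 1 := by
    rw [← MulChar.mul_apply, mul_inv_cancel, MulChar.one_apply hz.isUnit]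
  have hsum {φ : MulChar F R} (hφ : φ ≠ 1) : ∑ a, φ (z - a) = 0 := by
    simpa [MulChar.sum_eq_zero_of_ne_one hφ] using (Equiv.subLeft z).sum_comp φ
  have h₁ := sum_mulChar_mul_sub_eq χ χ hz
  have h₂ := sum_mulChar_mul_sub_eq χ⁻¹ χ⁻¹ hz
  have h₃ := sum_mulChar_mul_sub_eq χ χ⁻¹ hz
  have h₄ := sum_mulChar_mul_sub_eq χ⁻¹ χ hz
  rw [← MulChar.mul_apply, hsq] at h₁
  rw [← MulChar.mul_apply, hsq'] at h₂
  rw [hmul, jacobiSum_nontrivial_inv hχ1] at h₃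
  rw [mul_comm (χ⁻¹ z), hmul, jacobiSum_comm, jacobiSum_nontrivial_inv hχ1] at h₄
  rw [Ncube_two_eq_sum]
  push_cast
  simp only [MulChar.card_cube_roots hχ, add_mul, mul_add, one_mul, mul_one, sum_add_distrib,
    hsum hχ1, hsum (inv_ne_one.mpr hχ1), h₁, h₂, h₃, h₄, MulChar.sum_eq_zero_of_ne_one hχ1,
    MulChar.sum_eq_zero_of_ne_one (inv_ne_one.mpr hχ1), sum_const, card_univ, nsmul_eq_mul]
  ring

lemma MulChar.apply_neg_one_of_orderOf_eq_three {F R : Type*} [Field F] [CommRing R]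
    {χ : MulChar F R} (hχ : orderOf χ = 3) : χ (-1) = 1 := by
  have h₂ : χ (-1) ^ 2 = 1 := by rw [← map_pow, neg_one_sq, map_one]
  have h₃ : χ (-1) ^ 3 = 1 := by
    rw [← MulChar.pow_apply' χ three_ne_zero, ← hχ, pow_orderOf_eq_one,
      MulChar.one_apply isUnit_one.neg]
  rwa [pow_succ, h₂, one_mul] at h₃

lemma gaussSum_cube {F R : Type*} [Field F] [Fintype F] [CommRing R] [IsDomain R]
    {χ : MulChar F R} (hχ : orderOf χ = 3) {ψ : AddChar F R} (hψ : ψ.IsPrimitive) :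
    gaussSum χ ψ ^ 3 = Fintype.card F * jacobiSum χ χ := by
  have h := gaussSum_pow_eq_prod_jacobiSum (χ := χ) (by omega) hψ
  simpa [hχ, MulChar.apply_neg_one_of_orderOf_eq_three hχ] using h

lemma AddChar.isPrimitive_of_eq_exp_trace {p : ℕ} [Fact p.Prime] {F : Type*} [Field F] [Finite F]
    [Algebra (ZMod p) F] {ψ : AddChar F ℂ}
    (hψ : ∀ x : F, ψ x = Complex.exp (2 * (Real.pi : ℂ) * Complex.I
      * ((Algebra.trace (ZMod p) F x).val : ℂ) / (p : ℂ))) : ψ.IsPrimitive := by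
  refine AddChar.IsPrimitive.of_ne_one fun h ↦ ?_
  obtain ⟨x, hx⟩ := Algebra.trace_surjective (ZMod p) F 1
  have hp : p ≠ 1 := (Fact.out : p.Prime).ne_one
  have : Fact (1 < p) := ⟨(Fact.out : p.Prime).one_lt⟩
  have hx1 := hψ x
  rw [h, AddChar.one_apply, hx, ZMod.val_one, Nat.cast_one, mul_one] at hx1
  have hprim := Complex.isPrimitiveRoot_exp p (NeZero.ne p)
  rw [← hx1] at hprim
  exact hp (hprim.unique IsPrimitiveRoot.one)

lemma orderOf_neg_one_add_sqrt_three_mul_I_div_two :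
    orderOf ((-1 + (Real.sqrt 3 : ℂ) * Complex.I) / 2) = 3 := by
  have hs : (Real.sqrt 3 : ℂ) ^ 2 = 3 := by
    rw [← Complex.ofReal_pow, Real.sq_sqrt (by norm_num)]
    norm_num
  refine orderOf_eq_prime ?_ fun h ↦ ?_
  · have hI : ((Real.sqrt 3 : ℂ) * Complex.I) ^ 2 = -3 := by
      rw [mul_pow, hs, Complex.I_sq]
      ring
    linear_combination ((Real.sqrt 3 : ℂ) * Complex.I - 3) / 8 * hI
  · have := congrArg Complex.re h
    norm_num at this

/-- For every `z ∈ F_q*`, `q·(N₂(z) - q) = -2q + χ̄(z)·G(χ,ψ)³ + χ(z)·G(χ̄,ψ)³`. -/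
theorem qN2_identity
    (p k q : ℕ) [Fact p.Prime] (hk : 0 < k) (hq : q = p ^ k) (hq3 : q % 3 = 1)
    (F : Type) [Field F] [Fintype F] [Algebra (ZMod p) F] (hF : Fintype.card F = q)
    (g : Fˣ) (hg : ∀ x : Fˣ, x ∈ Subgroup.zpowers g)
    (χ : MulChar F ℂ) (hχ : χ (g : F) = (-1 + (Real.sqrt 3 : ℂ) * Complex.I) / 2)
    (ψ : AddChar F ℂ)
    (hψ : ∀ x : F, ψ x = Complex.exp (2 * (Real.pi : ℂ) * Complex.I
      * ((Algebra.trace (ZMod p) F x).val : ℂ) / (p : ℂ)))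
    (z : F) (hz : z ≠ 0) :
    (q : ℂ) * ((Ncube F 2 z : ℂ) - (q : ℂ))
      = -2 * (q : ℂ) + (χ.ringHomComp (starRingEnd ℂ)) z * gaussSum χ ψ ^ 3
          + χ z * gaussSum (χ.ringHomComp (starRingEnd ℂ)) ψ ^ 3 := by
  have hcubic : orderOf χ = 3 := by
    rw [← orderOf_neg_one_add_sqrt_three_mul_I_div_two, ← hχ]
    refine Nat.dvd_antisymm (orderOf_dvd_of_pow_eq_one ?_) (orderOf_dvd_of_pow_eq_one ?_)
    · rw [MulChar.eq_iff hg, MulChar.pow_apply_coe, pow_orderOf_eq_one, MulChar.one_apply_coe]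
    · rw [← MulChar.pow_apply_coe, pow_orderOf_eq_one, MulChar.one_apply_coe]
  have hconj : χ.ringHomComp (starRingEnd ℂ) = χ⁻¹ := MulChar.star_eq_inv χ
  have hprim := AddChar.isPrimitive_of_eq_exp_trace hψ
  rw [hconj, gaussSum_cube hcubic hprim, gaussSum_cube ((orderOf_inv χ).trans hcubic) hprim,
    Ncube_two_eq_jacobiSum hcubic hz, MulChar.apply_neg_one_of_orderOf_eq_three hcubic, hF]
  ring
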